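/- arXiv:2006.14456 — 2 statements merged into one kernel-verified Lean document; each statement's English description precedes it below -/
import Mathlib

section
/- In the self-similar Cantor-type setting, the p-dimensional Hausdorff measure of K with p = log N / log(1/λ) is finite and nonzero: 0 < H_p(K) < ∞. -/
open MeasureTheory
open scoped ENNReal

/-- The contracting similarity `F i x = λ • (x - b i) + b i` of `EuclideanSpace ℝ (Fin n)`. -/
noncomputable def cantorMap (n N : ℕ) (lam : ℝ) (b : Fin N → EuclideanSpace ℝ (Fin n))
    (i : Fin N) (x : EuclideanSpace ℝ (Fin n)) : EuclideanSpace ℝ (Fin n) :=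
  lam • (x - b i) + b i

/-- For a word `w = (w_1, …, w_L)`, the composition `F_w = F_{w_1} ∘ ⋯ ∘ F_{w_L}`. -/
noncomputable def cantorMapWord (n N : ℕ) (lam : ℝ) (b : Fin N → EuclideanSpace ℝ (Fin n))
    (w : List (Fin N)) : EuclideanSpace ℝ (Fin n) → EuclideanSpace ℝ (Fin n) :=
  w.foldr (fun i g => cantorMap n N lam b i ∘ g) id

/-- The cell `K_w = F_w '' K` of the self-similar set `K`. -/
noncomputable def cantorCell (n N : ℕ) (lam : ℝ) (b : Fin N → EuclideanSpace ℝ (Fin n))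
    (K : Set (EuclideanSpace ℝ (Fin n))) (w : List (Fin N)) :
    Set (EuclideanSpace ℝ (Fin n)) :=
  cantorMapWord n N lam b w '' K

open Filter Topology in
theorem aux_upper {E : Type*} [MetricSpace E] [MeasurableSpace E] [BorelSpace E]
    (N : ℕ) (lam : NNReal) (hlam1 : lam < 1) (F : Fin N → E → E)
    (hF : ∀ i, LipschitzWith lam (F i))
    (K : Set E) (hKcpt : IsCompact K) (hself : K = ⋃ i : Fin N, F i '' K)
    (p : ℝ) (hp : 0 < p) (hNp : (N : ℝ≥0∞) * (lam : ℝ≥0∞) ^ p = 1) : μH[p] K < ⊤ := by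
  have hcov : ∀ k : ℕ, ∃ s : Fin (N ^ k) → Set E, (K ⊆ ⋃ w, s w) ∧
      ∀ w, Metric.ediam (s w) ≤ (lam : ℝ≥0∞) ^ k * Metric.ediam K := by
    intro k
    induction k with
    | zero =>
      refine ⟨fun _ => K, ?_, by simp⟩
      intro x hx
      exact Set.mem_iUnion.2 ⟨⟨0, by simp⟩, hx⟩
    | succ k ih =>
      obtain ⟨s, hs, hd⟩ := ih
      refine ⟨fun w => F (finProdFinEquiv.symm (Fin.cast (pow_succ N k) w)).2 ''
        (s (finProdFinEquiv.symm (Fin.cast (pow_succ N k) w)).1), ?_, ?_⟩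
      · intro x hx
        rw [hself] at hx
        obtain ⟨i, y, hy, rfl⟩ := Set.mem_iUnion.1 hx
        obtain ⟨w, hw⟩ := Set.mem_iUnion.1 (hs hy)
        refine Set.mem_iUnion.2 ⟨Fin.cast (pow_succ N k).symm (finProdFinEquiv (w, i)), y, ?_, ?_⟩
        · simpa using hw
        · simp
      · intro v
        refine ((hF _).ediam_image_le _).trans ?_
        rw [pow_succ' (lam : ℝ≥0∞), mul_assoc]
        gcongr
        exact hd _
  choose s hc hd using hcov
  have hD : Metric.ediam K ≠ ⊤ := hKcpt.isBounded.ediam_ne_top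
  have hr : Tendsto (fun k : ℕ => (lam : ℝ≥0∞) ^ k * Metric.ediam K) atTop (𝓝 0) := by
    have h1 : Tendsto (fun k : ℕ => (lam : ℝ≥0∞) ^ k) atTop (𝓝 0) :=
      ENNReal.tendsto_pow_atTop_nhds_zero_of_lt_one (by exact_mod_cast hlam1)
    simpa using ENNReal.Tendsto.mul_const h1 (Or.inr hD)
  have h := Measure.hausdorffMeasure_le_liminf_sum p K _ hr s
    (Eventually.of_forall hd) (Eventually.of_forall hc)
  refine lt_of_le_of_lt (b := Metric.ediam K ^ p) (h.trans ?_)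
    (ENNReal.rpow_lt_top_of_nonneg hp.le hD)
  have hle : ∀ k, ∑ w, Metric.ediam (s k w) ^ p ≤ Metric.ediam K ^ p := by
    intro k
    calc ∑ w, Metric.ediam (s k w) ^ p
        ≤ ∑ w : Fin (N ^ k), ((lam : ℝ≥0∞) ^ k * Metric.ediam K) ^ p :=
          Finset.sum_le_sum fun w _ => ENNReal.rpow_le_rpow (hd k w) hp.le
      _ = ((N : ℝ≥0∞) * (lam : ℝ≥0∞) ^ p) ^ k * Metric.ediam K ^ p := by
          rw [Finset.sum_const, ENNReal.mul_rpow_of_nonneg _ _ hp.le, mul_pow, nsmul_eq_mul,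
            ← ENNReal.rpow_natCast, ← ENNReal.rpow_natCast ((lam : ℝ≥0∞) ^ p),
            ← ENNReal.rpow_mul, ← ENNReal.rpow_mul, mul_comm p]
          simp [mul_assoc]
      _ = _ := by rw [hNp]; simp
  calc _ ≤ liminf (fun _ : ℕ => Metric.ediam K ^ p) atTop :=
        liminf_le_liminf (Eventually.of_forall hle)
    _ = _ := liminf_const _

open Filter Topology in
theorem aux_lower {E : Type*} [MetricSpace E] [MeasurableSpace E] [BorelSpace E]
    (N : ℕ) (hN : 2 ≤ N) (lam : ℝ) (hlam0 : 0 < lam) (hlam1 : lam < 1) (F : Fin N → E → E)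
    (hF : ∀ i x y, dist (F i x) (F i y) = lam * dist x y)
    (K : Set E) (hKne : K.Nonempty) (hKcpt : IsCompact K) (hself : K = ⋃ i : Fin N, F i '' K)
    (hdisj : ∀ i j, i ≠ j → (F i '' K) ∩ (F j '' K) = ∅)
    (p : ℝ) (hp : 0 < p) (hNp : (N : ℝ) * lam ^ p = 1) : 0 < μH[p] K := by
  have hN0 : (0 : ℝ) < N := by exact_mod_cast (by omega : 0 < N)
  have hcont : ∀ i, Continuous (F i) := fun i =>
    (LipschitzWith.of_dist_le_mul (K := NNReal.mk lam hlam0.le)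
      (fun x y => (hF i x y).le)).continuous
  have hFK : ∀ i, ∀ x ∈ K, F i x ∈ K := fun i x hx => by
    rw [hself]; exact Set.mem_iUnion.2 ⟨i, x, hx, rfl⟩
  -- separation constant
  obtain ⟨δ, hδ, hδ0⟩ : ∃ δ : ℝ, (∀ i j, i ≠ j → ∀ x ∈ K, ∀ y ∈ K, δ ≤ dist (F i x) (F j y)) ∧
      0 < δ := by
    have h : ∀ᶠ δ : ℝ in 𝓝[>] 0, ∀ i j, i ≠ j → ∀ x ∈ K, ∀ y ∈ K,
        δ ≤ dist (F i x) (F j y) := by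
      refine eventually_all.2 fun i => eventually_all.2 fun j => ?_
      by_cases hij : i = j
      · exact Eventually.of_forall fun _ h => absurd hij h
      obtain ⟨r, hr, h⟩ := Metric.exists_pos_forall_lt_edist (hKcpt.image (hcont i))
        (hKcpt.image (hcont j)).isClosed (Set.disjoint_iff_inter_eq_empty.2 (hdisj i j hij))
      have hr' : (0 : ℝ) < r := by exact_mod_cast hr
      filter_upwards [nhdsWithin_le_nhds (Iio_mem_nhds hr')] with δ hδ _ x hx y hy
      have h1 := h _ ⟨x, hx, rfl⟩ _ ⟨y, hy, rfl⟩
      rw [edist_nndist] at h1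
      have h2 : (r : ℝ) < dist (F i x) (F j y) := by
        rw [← coe_nndist]; exact_mod_cast h1
      exact (lt_trans hδ h2).le
    obtain ⟨δ, h1, h2⟩ := (h.and self_mem_nhdsWithin).exists
    exact ⟨δ, h1, h2⟩
  have hex : ∀ x, ∃ i : Fin N, ∃ y : E, x ∈ K → y ∈ K ∧ F i y = x := by
    intro x
    by_cases hx : x ∈ K
    · have hx' := hx
      rw [hself] at hx'
      obtain ⟨i, y, hy, h⟩ := Set.mem_iUnion.1 hx'
      exact ⟨i, y, fun _ => ⟨hy, h⟩⟩
    · exact ⟨⟨0, by omega⟩, x, fun h => absurd h hx⟩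
  choose dig T hT using hex
  obtain ⟨f, hf⟩ : ∃ f : E → ℝ, f = fun x => Real.ofDigits (fun k => dig (T^[k] x)) := ⟨_, rfl⟩
  have hf0 : ∀ x, 0 ≤ f x := fun x => by rw [hf]; exact Real.ofDigits_nonneg _
  have hf1 : ∀ x, f x ≤ 1 := fun x => by rw [hf]; exact Real.ofDigits_le_one _
  have hfe : ∀ x, f x = ((dig x : ℕ) + f (T x)) / N := by
    intro x
    have h := Real.ofDigits_eq_sum_add_ofDigits (fun k => dig (T^[k] x)) 1
    simp only [Finset.sum_range_one, Real.ofDigitsTerm, Function.iterate_succ_apply,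
      Function.iterate_zero, id, zero_add, pow_one] at h
    rw [hf]
    simp only
    rw [h]
    ring
  -- the address of `F i y`
  have haddr : ∀ i, ∀ y ∈ K, dig (F i y) = i ∧ T (F i y) = y := by
    intro i y hy
    obtain ⟨h1, h2⟩ := hT _ (hFK i y hy)
    have hd : dig (F i y) = i := by
      by_contra hne
      have := hδ _ _ hne _ h1 _ hy
      rw [h2, dist_self] at this
      linarith
    refine ⟨hd, ?_⟩
    rw [hd] at h2
    have h3 := hF i (T (F i y)) y
    rw [h2, dist_self] at h3
    have : dist (T (F i y)) y = 0 := by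
      rcases mul_eq_zero.1 h3.symm with h | h
      · linarith
      · exact h
    exact dist_eq_zero.1 this
  have hbig : ∀ x y : E, δ ≤ dist x y → |f x - f y| ≤ (dist x y / δ) ^ p := by
    intro x y h
    have h1 : |f x - f y| ≤ 1 := by
      rw [abs_le]; constructor <;> linarith [hf0 x, hf0 y, hf1 x, hf1 y]
    exact h1.trans (Real.one_le_rpow ((one_le_div hδ0).2 h) hp.le)
  have hhol : ∀ k : ℕ, ∀ x ∈ K, ∀ y ∈ K, δ * lam ^ k ≤ dist x y →
      |f x - f y| ≤ (dist x y / δ) ^ p := by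
    intro k
    induction k with
    | zero => intro x _ y _ h; exact hbig x y (by simpa using h)
    | succ k ih =>
      intro x hx y hy h
      obtain ⟨hx1, hx2⟩ := hT x hx
      obtain ⟨hy1, hy2⟩ := hT y hy
      by_cases hd : dig x = dig y
      · have hdist : dist x y = lam * dist (T x) (T y) := by
          rw [← hF (dig x), hx2, hd, hy2]
        have h1 := ih _ hx1 _ hy1 (by
          rw [hdist, pow_succ] at h
          by_contra! hlt
          nlinarith)
        have e : f x - f y = (f (T x) - f (T y)) / N := by
          rw [hfe x, hfe y, hd]; ring
        rw [e, abs_div, abs_of_pos hN0, hdist, mul_div_assoc,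
          Real.mul_rpow hlam0.le (by positivity), div_le_iff₀ hN0]
        calc _ ≤ _ := h1
          _ = (N * lam ^ p) * (dist (T x) (T y) / δ) ^ p := by rw [hNp, one_mul]
          _ = _ := by ring
      · apply hbig
        have := hδ _ _ hd _ hx1 _ hy1
        rwa [hx2, hy2] at this
  have hhol' : ∀ x ∈ K, ∀ y ∈ K, |f x - f y| ≤ (1 / δ) ^ p * dist x y ^ p := by
    intro x hx y hy
    rw [← Real.mul_rpow (by positivity) dist_nonneg, one_div_mul_eq_div]
    rcases eq_or_ne x y with rfl | hne
    · simp only [sub_self, abs_zero]; positivity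
    have hpos : 0 < dist x y / δ := div_pos (dist_pos.2 hne) hδ0
    obtain ⟨k, hk⟩ := exists_pow_lt_of_lt_one hpos hlam1
    refine hhol k x hx y hy ?_
    rw [lt_div_iff₀ hδ0] at hk
    linarith
  have hH : HolderOnWith (NNReal.mk ((1 / δ) ^ p) (by positivity)) (NNReal.mk p hp.le) f K := by
    intro x hx y hy
    have h := hhol' x hx y hy
    rw [edist_dist, edist_dist, Real.dist_eq]
    rw [NNReal.coe_mk, ENNReal.ofReal_rpow_of_nonneg dist_nonneg hp.le]
    refine (ENNReal.ofReal_le_ofReal h).trans ?_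
    rw [ENNReal.ofReal_mul (by positivity)]
    gcongr
    rw [← ENNReal.ofReal_coe_nnreal]
    rfl
  have hp' : (0 : NNReal) < NNReal.mk p hp.le := hp
  -- density
  have hdense : ∀ k : ℕ, ∀ y ∈ Set.Icc (0 : ℝ) 1, ∃ x ∈ K, |f x - y| ≤ (1 / (N : ℝ)) ^ k := by
    intro k
    induction k with
    | zero =>
      rintro y ⟨hy0, hy1⟩
      obtain ⟨x, hx⟩ := hKne
      refine ⟨x, hx, ?_⟩
      rw [pow_zero, abs_le]
      constructor <;> linarith [hf0 x, hf1 x]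
    | succ k ih =>
      rintro y ⟨hy0, hy1⟩
      obtain ⟨i, hi0, hi1⟩ : ∃ i : Fin N, ((i : ℕ) : ℝ) ≤ N * y ∧ N * y ≤ (i : ℕ) + 1 := by
        have hNy : 0 ≤ (N : ℝ) * y := by positivity
        by_cases h : ⌊(N : ℝ) * y⌋₊ < N
        · exact ⟨⟨_, h⟩, Nat.floor_le hNy, (Nat.lt_floor_add_one _).le⟩
        · have h1 : (N : ℝ) ≤ N * y := by
            refine le_trans ?_ (Nat.floor_le hNy)
            exact_mod_cast not_lt.1 h
          have h2 : (N : ℝ) * y ≤ N := by nlinarith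
          refine ⟨⟨N - 1, by omega⟩, ?_, ?_⟩
          · simp only
            rw [Nat.cast_sub (by omega)]; push_cast; linarith
          · simp only
            rw [Nat.cast_sub (by omega)]; push_cast; linarith
      obtain ⟨x, hx, h⟩ := ih (N * y - (i : ℕ)) ⟨by linarith, by linarith⟩
      refine ⟨F i x, hFK i x hx, ?_⟩
      have e : f (F i x) - y = (f x - (N * y - (i : ℕ))) / N := by
        rw [hfe, (haddr i x hx).1, (haddr i x hx).2]
        field_simp
        ring
      rw [e, abs_div, abs_of_pos hN0, pow_succ, mul_one_div]
      gcongr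
  have hsub : Set.Icc (0 : ℝ) 1 ⊆ f '' K := by
    have hcl : IsClosed (f '' K) := (hKcpt.image_of_continuousOn (hH.continuousOn hp')).isClosed
    intro y hy
    rw [← hcl.closure_eq, Metric.mem_closure_iff]
    intro ε hε
    have hN1 : 1 / (N : ℝ) < 1 := by
      rw [div_lt_one hN0]; exact_mod_cast (by omega : 1 < N)
    obtain ⟨k, hk⟩ := exists_pow_lt_of_lt_one hε hN1
    obtain ⟨x, hx, h⟩ := hdense k y hy
    refine ⟨f x, ⟨x, hx, rfl⟩, ?_⟩
    rw [dist_comm, Real.dist_eq]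
    exact h.trans_lt hk
  have h1 := (measure_mono (μ := μH[1]) hsub).trans
    (hH.hausdorffMeasure_image_le hp' zero_le_one)
  rw [hausdorffMeasure_real, Real.volume_Icc, NNReal.coe_mk, mul_one] at h1
  by_contra h0
  rw [not_lt, nonpos_iff_eq_zero] at h0
  rw [h0, mul_zero] at h1
  norm_num at h1

/-- Section 4 of the paper: the `p`-Hausdorff measure of the Cantor-type self-similar
set `K`, with `p = log N / log (1/λ)`, is finite and nonzero. -/
theorem stmt_10 (n N : ℕ) (hn : 1 ≤ n) (hN : 2 ≤ N) (lam : ℝ) (hlam0 : 0 < lam)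
    (hlam1 : lam < 1) (b : Fin N → EuclideanSpace ℝ (Fin n))
    (K : Set (EuclideanSpace ℝ (Fin n))) (hKne : K.Nonempty) (hKcpt : IsCompact K)
    (hself : K = ⋃ i : Fin N, cantorMap n N lam b i '' K)
    (hdisj : ∀ i j : Fin N, i ≠ j →
      (cantorMap n N lam b i '' K) ∩ (cantorMap n N lam b j '' K) = ∅)
    (p : ℝ) (hp : p = Real.log N / Real.log (1 / lam)) :
    0 < μH[p] K ∧ μH[p] K < ⊤ := by
  have hl : 0 < Real.log (1 / lam) := Real.log_pos (by rw [lt_div_iff₀ hlam0]; linarith)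
  have hN1 : (1 : ℝ) < N := by exact_mod_cast (by omega : 1 < N)
  have hp0 : 0 < p := by rw [hp]; exact div_pos (Real.log_pos hN1) hl
  have hNp : (N : ℝ) * lam ^ p = 1 := by
    have h1 : lam ^ p = (N : ℝ)⁻¹ := by
      rw [Real.rpow_def_of_pos hlam0]
      have h2 : Real.log lam * p = - Real.log N := by
        rw [hp, one_div, Real.log_inv] at *
        have : Real.log lam ≠ 0 := by intro h; rw [h] at hl; simp at hl
        field_simp
      rw [h2, Real.exp_neg, Real.exp_log (by linarith)]
    rw [h1, mul_inv_cancel₀ (by linarith)]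
  have hF : ∀ i x y, dist (cantorMap n N lam b i x) (cantorMap n N lam b i y)
      = lam * dist x y := by
    intro i x y
    simp only [cantorMap]
    rw [dist_add_right, dist_smul₀, dist_sub_right, Real.norm_of_nonneg hlam0.le]
  refine ⟨aux_lower N hN lam hlam0 hlam1 _ hF K hKne hKcpt hself hdisj p hp0 hNp, ?_⟩
  refine aux_upper N (NNReal.mk lam hlam0.le) hlam1 _
    (fun i => LipschitzWith.of_dist_le_mul fun x y => (hF i x y).le) K hKcpt hself p hp0 ?_
  have h3 : ((NNReal.mk lam hlam0.le : NNReal) : ℝ≥0∞) = ENNReal.ofReal lam := by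
    rw [← ENNReal.ofReal_coe_nnreal]
    rfl
  rw [h3, ENNReal.ofReal_rpow_of_pos hlam0, ← ENNReal.ofReal_natCast,
    ← ENNReal.ofReal_mul (by linarith), hNp, ENNReal.ofReal_one]
end

section
/- In the self-similar Cantor-type setting, the Hutchinson measure is determined by its values on cells: if μ and ν are Borel measures on E = EuclideanSpace ℝ (Fin n) such that μ(E ∖ K) = ν(E ∖ K) = 0 and μ(K_w) = ν(K_w) = N^{-L} for every L ∈ ℕ and every word w ∈ (Fin N)^L (in particular μ(K) = ν(K) = 1), then μ(B) = ν(B) for every Borel set B ⊆ E. -/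
open MeasureTheory
open scoped ENNReal

section helpers

variable {n N : ℕ} {lam : ℝ} {b : Fin N → EuclideanSpace ℝ (Fin n)}
  {K : Set (EuclideanSpace ℝ (Fin n))}

lemma cell_nil : cantorCell n N lam b K [] = K := by
  simp [cantorCell, cantorMapWord]

lemma cell_cons (i : Fin N) (w : List (Fin N)) :
    cantorCell n N lam b K (i :: w) = cantorMap n N lam b i '' cantorCell n N lam b K w := by
  simp only [cantorCell, cantorMapWord, List.foldr_cons]
  rw [Set.image_comp]

lemma cmap_inj (h : 0 < lam) (i : Fin N) : Function.Injective (cantorMap n N lam b i) := by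
  intro x y hxy
  simp only [cantorMap, add_left_inj] at hxy
  have := smul_right_injective _ h.ne' hxy
  simpa using this

lemma cmap_dist (h : 0 < lam) (i : Fin N) (x y : EuclideanSpace ℝ (Fin n)) :
    dist (cantorMap n N lam b i x) (cantorMap n N lam b i y) = lam * dist x y := by
  simp only [cantorMap, dist_add_right, dist_smul₀, dist_sub_right, Real.norm_eq_abs,
    abs_of_pos h]

lemma cell_compact (hK : IsCompact K) (w : List (Fin N)) :
    IsCompact (cantorCell n N lam b K w) := by
  induction w with
  | nil => rwa [cell_nil]
  | cons i w ih =>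
    rw [cell_cons]
    refine ih.image ?_
    unfold cantorMap
    fun_prop

lemma cell_subset (hself : K = ⋃ i : Fin N, cantorMap n N lam b i '' K) (w : List (Fin N)) :
    cantorCell n N lam b K w ⊆ K := by
  induction w with
  | nil => rw [cell_nil]
  | cons i w ih =>
    rw [cell_cons]
    refine (Set.image_mono ih).trans ?_
    conv_rhs => rw [hself]
    exact Set.subset_iUnion (fun i => cantorMap n N lam b i '' K) i

lemma cell_dist (h : 0 < lam) (hK : IsCompact K) (w : List (Fin N)) :
    ∀ x ∈ cantorCell n N lam b K w, ∀ y ∈ cantorCell n N lam b K w,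
      dist x y ≤ lam ^ w.length * Metric.diam K := by
  induction w with
  | nil =>
    rw [cell_nil]
    intro x hx y hy
    simpa using Metric.dist_le_diam_of_mem hK.isBounded hx hy
  | cons i w ih =>
    rw [cell_cons]
    rintro _ ⟨x, hx, rfl⟩ _ ⟨y, hy, rfl⟩
    rw [cmap_dist h, List.length_cons, pow_succ', mul_assoc]
    exact mul_le_mul_of_nonneg_left (ih x hx y hy) h.le

lemma cell_cover (hself : K = ⋃ i : Fin N, cantorMap n N lam b i '' K) (L : ℕ) :
    ∀ x ∈ K, ∃ w : List (Fin N), w.length = L ∧ x ∈ cantorCell n N lam b K w := by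
  induction L with
  | zero => exact fun x hx => ⟨[], rfl, by rwa [cell_nil]⟩
  | succ L ih =>
    intro x hx
    rw [hself] at hx
    obtain ⟨i, y, hy, rfl⟩ := Set.mem_iUnion.1 hx
    obtain ⟨w, hw, hyw⟩ := ih y hy
    refine ⟨i :: w, by simp [hw], ?_⟩
    rw [cell_cons]
    exact ⟨y, hyw, rfl⟩

lemma cell_disj (h : 0 < lam) (hself : K = ⋃ i : Fin N, cantorMap n N lam b i '' K)
    (hdisj : ∀ i j : Fin N, i ≠ j →
      (cantorMap n N lam b i '' K) ∩ (cantorMap n N lam b j '' K) = ∅) (w : List (Fin N)) :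
    ∀ v : List (Fin N), v.length = w.length → w ≠ v →
      Disjoint (cantorCell n N lam b K w) (cantorCell n N lam b K v) := by
  induction w with
  | nil =>
    intro v hv hne
    exact absurd (List.length_eq_zero_iff.1 hv).symm hne
  | cons i w ih =>
    intro v hv hne
    cases v with
    | nil => simp at hv
    | cons j v =>
      rw [cell_cons, cell_cons]
      by_cases hij : i = j
      · subst hij
        rw [Set.disjoint_image_iff (cmap_inj h i)]
        exact ih v (by simpa using hv) (fun e => hne (by rw [e]))
      · exact (Set.disjoint_iff_inter_eq_empty.2 (hdisj i j hij)).mono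
          (Set.image_mono (cell_subset hself w)) (Set.image_mono (cell_subset hself v))

lemma closed_le (hlam0 : 0 < lam) (hlam1 : lam < 1) (hKcpt : IsCompact K)
    (hself : K = ⋃ i : Fin N, cantorMap n N lam b i '' K)
    (hdisj : ∀ i j : Fin N, i ≠ j →
      (cantorMap n N lam b i '' K) ∩ (cantorMap n N lam b j '' K) = ∅)
    (μ ν : Measure (EuclideanSpace ℝ (Fin n))) [IsFiniteMeasure ν]
    (hμK : μ Kᶜ = 0)
    (hcell : ∀ w : List (Fin N),
      μ (cantorCell n N lam b K w) = ν (cantorCell n N lam b K w))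
    (C : Set (EuclideanSpace ℝ (Fin n))) (hC : IsClosed C) : μ C ≤ ν C := by
  classical
  have key : ∀ L : ℕ, μ C ≤ ν (Metric.cthickening (lam ^ L * Metric.diam K) C) := by
    intro L
    let S : Finset (List.Vector (Fin N) L) :=
      Finset.univ.filter fun w => (cantorCell n N lam b K w.1 ∩ C).Nonempty
    have hm : ∀ ρ : Measure (EuclideanSpace ℝ (Fin n)),
        ρ (⋃ w ∈ S, cantorCell n N lam b K w.1) = ∑ w ∈ S, ρ (cantorCell n N lam b K w.1) := by
      intro ρ
      refine measure_biUnion_finset ?_ fun w _ => (cell_compact hKcpt w.1).measurableSet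
      intro w _ v _ hwv
      exact cell_disj hlam0 hself hdisj w.1 v.1 (by rw [w.2, v.2])
        (fun e => hwv (Subtype.ext e))
    calc μ C ≤ μ ((⋃ w ∈ S, cantorCell n N lam b K w.1) ∪ Kᶜ) := by
          refine measure_mono fun x hx => ?_
          by_cases hxK : x ∈ K
          · obtain ⟨w, hw, hxw⟩ := cell_cover hself L x hxK
            refine Or.inl (Set.mem_iUnion₂.2 ⟨⟨w, hw⟩, ?_, hxw⟩)
            exact Finset.mem_filter.2 ⟨Finset.mem_univ _, x, hxw, hx⟩
          · exact Or.inr hxK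
      _ ≤ μ (⋃ w ∈ S, cantorCell n N lam b K w.1) + μ Kᶜ := measure_union_le _ _
      _ = ν (⋃ w ∈ S, cantorCell n N lam b K w.1) := by
          rw [hμK, add_zero, hm, hm]
          exact Finset.sum_congr rfl fun w _ => hcell w.1
      _ ≤ _ := by
          refine measure_mono fun x hx => ?_
          obtain ⟨w, hw, hxw⟩ := Set.mem_iUnion₂.1 hx
          obtain ⟨y, hyw, hyC⟩ := (Finset.mem_filter.1 hw).2
          refine Metric.mem_cthickening_of_dist_le x y _ C hyC ?_
          have := cell_dist hlam0 hKcpt w.1 x hxw y hyw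
          rwa [w.2] at this
  have ht : Filter.Tendsto (fun L : ℕ => lam ^ L * Metric.diam K) Filter.atTop (nhds 0) := by
    simpa using (tendsto_pow_atTop_nhds_zero_of_lt_one hlam0.le hlam1).mul_const (Metric.diam K)
  have h2 := (tendsto_measure_cthickening_of_isClosed (μ := ν)
    ⟨1, one_pos, measure_ne_top _ _⟩ hC).comp ht
  exact ge_of_tendsto' h2 key

end helpers

/-- Section 4 of the paper: uniqueness of the Hutchinson measure. Two Borel measures on
`EuclideanSpace ℝ (Fin n)` that vanish off `K` and give each cell `K_w` (for a word `w`
of length `L`) the measure `N^{-L}` agree on all Borel sets. -/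
theorem stmt_18 (n N : ℕ) (hn : 1 ≤ n) (hN : 2 ≤ N) (lam : ℝ) (hlam0 : 0 < lam)
    (hlam1 : lam < 1) (b : Fin N → EuclideanSpace ℝ (Fin n))
    (K : Set (EuclideanSpace ℝ (Fin n))) (hKne : K.Nonempty) (hKcpt : IsCompact K)
    (hself : K = ⋃ i : Fin N, cantorMap n N lam b i '' K)
    (hdisj : ∀ i j : Fin N, i ≠ j →
      (cantorMap n N lam b i '' K) ∩ (cantorMap n N lam b j '' K) = ∅)
    (μ ν : Measure (EuclideanSpace ℝ (Fin n)))
    (hμK : μ Kᶜ = 0) (hνK : ν Kᶜ = 0)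
    (hμcell : ∀ (L : ℕ) (w : List (Fin N)), w.length = L →
      μ (cantorCell n N lam b K w) = ((N : ℝ≥0∞) ^ L)⁻¹)
    (hνcell : ∀ (L : ℕ) (w : List (Fin N)), w.length = L →
      ν (cantorCell n N lam b K w) = ((N : ℝ≥0∞) ^ L)⁻¹) :
    ∀ B : Set (EuclideanSpace ℝ (Fin n)), MeasurableSet B → μ B = ν B := by
  have hfin : ∀ ρ : Measure (EuclideanSpace ℝ (Fin n)), ρ Kᶜ = 0 →
      (∀ (L : ℕ) (w : List (Fin N)), w.length = L →
        ρ (cantorCell n N lam b K w) = ((N : ℝ≥0∞) ^ L)⁻¹) → IsFiniteMeasure ρ := by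
    intro ρ h0 h1
    have h2 := h1 0 [] rfl
    rw [cell_nil] at h2
    refine ⟨?_⟩
    rw [← Set.union_compl_self K]
    refine (measure_union_le _ _).trans_lt ?_
    simp [h0, h2]
  haveI := hfin μ hμK hμcell
  haveI := hfin ν hνK hνcell
  have hc : ∀ w : List (Fin N),
      μ (cantorCell n N lam b K w) = ν (cantorCell n N lam b K w) := fun w => by
    rw [hμcell _ w rfl, hνcell _ w rfl]
  have hcl : ∀ C : Set (EuclideanSpace ℝ (Fin n)), IsClosed C → μ C = ν C := fun C hC =>
    le_antisymm (closed_le hlam0 hlam1 hKcpt hself hdisj μ ν hμK hc C hC)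
      (closed_le hlam0 hlam1 hKcpt hself hdisj ν μ hνK (fun w => (hc w).symm) C hC)
  have : μ = ν := by
    refine ext_of_generate_finite {C | IsClosed C} ?_ isPiSystem_isClosed
      (fun C hC => hcl C hC) (hcl _ isClosed_univ)
    rw [BorelSpace.measurable_eq (α := EuclideanSpace ℝ (Fin n))]
    exact borel_eq_generateFrom_isClosed
  intro B _
  rw [this]
end
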